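/- (Trade-off between information and information loss for qubit thermometry.) For δ > 0, β > 0 and every binary qubit POVM in conical coordinates (w, λ, θ, φ), the Fisher information and the Δ-disturbance satisfy the exact identity F_β = κ(χ) · D^{(Δ)}, where χ = sinθ and κ(χ) = 2(1 − χ²)/(2 − χ² + χ² cosh(βδ)). -/

import Mathlib

open Matrix ComplexOrder Real

noncomputable def pauliX : Matrix (Fin 2) (Fin 2) ℂ := !![0, 1; 1, 0]
noncomputable def pauliY : Matrix (Fin 2) (Fin 2) ℂ := !![0, -Complex.I; Complex.I, 0]
noncomputable def pauliZ : Matrix (Fin 2) (Fin 2) ℂ := !![1, 0; 0, -1]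

/-- The thermal qubit state `ρ_β = diag(e^{−βδ/2}, e^{βδ/2})/(2 cosh(βδ/2))`. -/
noncomputable def rhoTherm (δ β : ℝ) : Matrix (Fin 2) (Fin 2) ℂ :=
  ((2 * Real.cosh (β * δ / 2) : ℝ)⁻¹ : ℂ) •
    !![Complex.exp (-(β * δ / 2)), 0; 0, Complex.exp (β * δ / 2)]

/-- The POVM element `Π₀` of a binary qubit POVM in conical coordinates. -/
noncomputable def povm0 (w l θ φ : ℝ) : Matrix (Fin 2) (Fin 2) ℂ :=
  (w : ℂ) • ((1 : Matrix (Fin 2) (Fin 2) ℂ)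
    + ((l * Real.sin θ * Real.cos φ : ℝ) : ℂ) • pauliX
    + ((l * Real.sin θ * Real.sin φ : ℝ) : ℂ) • pauliY
    + ((l * Real.cos θ : ℝ) : ℂ) • pauliZ)

/-- The POVM element `Π₁ = I₂ − Π₀`. -/
noncomputable def povm1 (w l θ φ : ℝ) : Matrix (Fin 2) (Fin 2) ℂ :=
  1 - povm0 w l θ φ

/-- The outcome probability `p₀(β) = tr(ρ_β Π₀)`. -/
noncomputable def prob0 (δ β w l θ φ : ℝ) : ℝ :=
  ((rhoTherm δ β * povm0 w l θ φ).trace).re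

/-- The Fisher information of the measurement, `F_β = (dp₀/dβ)²/(p₀ p₁)`. -/
noncomputable def fisherInfo (δ β w l θ φ : ℝ) : ℝ :=
  (deriv (fun b => prob0 δ b w l θ φ) β) ^ 2 /
    (prob0 δ β w l θ φ * (1 - prob0 δ β w l θ φ))
/-- The quantum Fisher information `F^Q = δ²/(2 + 2cosh(βδ))` of the thermal qubit model. -/
noncomputable def qfiModel (δ β : ℝ) : ℝ := δ ^ 2 / (2 + 2 * Real.cosh (β * δ))

/-- The QFI `Q₀` of the post-measurement state for outcome 0. -/
noncomputable def qfiPost0 (δ β l θ : ℝ) : ℝ :=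
  δ ^ 2 * (1 - l ^ 2) * Real.exp (β * δ) /
    ((1 + l * Real.cos θ) + Real.exp (β * δ) * (1 - l * Real.cos θ)) ^ 2

/-- The QFI `Q₁` of the post-measurement state for outcome 1. -/
noncomputable def qfiPost1 (δ β w l θ : ℝ) : ℝ :=
  δ ^ 2 * ((1 - w) ^ 2 - l ^ 2 * w ^ 2) * Real.exp (β * δ) /
    (1 - w * (1 + l * Real.cos θ) + Real.exp (β * δ) * (1 - w * (1 - l * Real.cos θ))) ^ 2

/-- The Δ-disturbance (information loss) `D^{(Δ)} = F^Q − p₀Q₀ − p₁Q₁`. -/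
noncomputable def deltaDist (δ β w l θ φ : ℝ) : ℝ :=
  qfiModel δ β - prob0 δ β w l θ φ * qfiPost0 δ β l θ -
    (1 - prob0 δ β w l θ φ) * qfiPost1 δ β w l θ

theorem prob0_eq (δ β w l θ φ : ℝ) :
    prob0 δ β w l θ φ =
      w * ((1 + l * Real.cos θ) + Real.exp (β * δ) * (1 - l * Real.cos θ)) /
        (1 + Real.exp (β * δ)) := by
  have hform : prob0 δ β w l θ φ =
      (2 * Real.cosh (β * δ / 2))⁻¹ * (Real.exp (-(β * δ / 2)) * (w * (1 + l * Real.cos θ)) +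
        Real.exp (β * δ / 2) * (w * (1 - l * Real.cos θ))) := by
    have h : (rhoTherm δ β * povm0 w l θ φ).trace =
        (((2 * Real.cosh (β * δ / 2))⁻¹ * (Real.exp (-(β * δ / 2)) * (w * (1 + l * Real.cos θ)) +
          Real.exp (β * δ / 2) * (w * (1 - l * Real.cos θ))) : ℝ) : ℂ) := by
      rw [Matrix.trace_fin_two, Matrix.mul_apply, Matrix.mul_apply, Fin.sum_univ_two,
        Fin.sum_univ_two]
      simp [rhoTherm, povm0, pauliX, pauliY, pauliZ]
      ring
    rw [prob0, h, Complex.ofReal_re]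
  have hsq : Real.exp (β * δ) = Real.exp (β * δ / 2) ^ 2 := by
    rw [← Real.exp_nat_mul]; congr 1; push_cast; ring
  have hpos := Real.exp_pos (β * δ / 2)
  rw [hform, Real.cosh_eq, hsq, Real.exp_neg]
  field_simp
  ring

theorem deriv_prob0 (δ β w l θ φ : ℝ) :
    deriv (fun b => prob0 δ b w l θ φ) β =
      -(2 * w * δ * (l * Real.cos θ) * Real.exp (β * δ)) / (1 + Real.exp (β * δ)) ^ 2 := by
  have hE : HasDerivAt (fun b : ℝ => Real.exp (b * δ)) (Real.exp (β * δ) * (1 * δ)) β :=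
    ((hasDerivAt_id β).mul_const δ).exp
  have hne : 1 + Real.exp (β * δ) ≠ 0 := by positivity
  have h := (((hE.mul_const (1 - l * Real.cos θ)).const_add (1 + l * Real.cos θ)).const_mul
    w).fun_div (hE.const_add 1) hne
  simp_rw [prob0_eq]
  rw [h.deriv]
  congr 1
  ring

theorem cosh_eq_exp_sq_add_one_div (x : ℝ) :
    Real.cosh x = (Real.exp x ^ 2 + 1) / (2 * Real.exp x) := by
  rw [Real.cosh_eq, Real.exp_neg]
  field_simp

theorem information_disturbance_identity {δ E w l c s : ℝ} (hE : 0 < E) (hw : w ≠ 0)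
    (hcs : c ^ 2 = 1 - s ^ 2)
    (hA : (1 + l * c) + E * (1 - l * c) ≠ 0)
    (hB : 1 - w * (1 + l * c) + E * (1 - w * (1 - l * c)) ≠ 0) :
    (-(2 * w * δ * (l * c) * E) / (1 + E) ^ 2) ^ 2 /
        (w * ((1 + l * c) + E * (1 - l * c)) / (1 + E) *
          (1 - w * ((1 + l * c) + E * (1 - l * c)) / (1 + E))) =
      2 * (1 - s ^ 2) / (2 - s ^ 2 + s ^ 2 * ((E ^ 2 + 1) / (2 * E))) *
        (δ ^ 2 / (2 + 2 * ((E ^ 2 + 1) / (2 * E))) -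
          w * ((1 + l * c) + E * (1 - l * c)) / (1 + E) *
            (δ ^ 2 * (1 - l ^ 2) * E / ((1 + l * c) + E * (1 - l * c)) ^ 2) -
          (1 - w * ((1 + l * c) + E * (1 - l * c)) / (1 + E)) *
            (δ ^ 2 * ((1 - w) ^ 2 - l ^ 2 * w ^ 2) * E /
              (1 - w * (1 + l * c) + E * (1 - w * (1 - l * c))) ^ 2)) := by
  have hS : 1 + E ≠ 0 := by positivity
  have hG : 4 * E + s ^ 2 * (E - 1) ^ 2 ≠ 0 := by positivity
  have hp1 : 1 - w * ((1 + l * c) + E * (1 - l * c)) / (1 + E) =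
      (1 - w * (1 + l * c) + E * (1 - w * (1 - l * c))) / (1 + E) := by
    field_simp
    ring
  have hQ : δ ^ 2 / (2 + 2 * ((E ^ 2 + 1) / (2 * E))) = δ ^ 2 * E / (1 + E) ^ 2 := by
    have : 2 + 2 * ((E ^ 2 + 1) / (2 * E)) = (1 + E) ^ 2 / E := by
      field_simp
      ring
    rw [this, div_div_eq_mul_div]
  have hκ : 2 * (1 - s ^ 2) / (2 - s ^ 2 + s ^ 2 * ((E ^ 2 + 1) / (2 * E))) =
      4 * c ^ 2 * E / (4 * E + s ^ 2 * (E - 1) ^ 2) := by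
    have : 2 - s ^ 2 + s ^ 2 * ((E ^ 2 + 1) / (2 * E)) =
        (4 * E + s ^ 2 * (E - 1) ^ 2) / (2 * E) := by
      field_simp
      ring
    rw [this, div_div_eq_mul_div, hcs]
    ring
  rw [hp1, hQ, hκ]
  have hloss : ((1 + l * c) + E * (1 - l * c)) *
        (1 - w * (1 + l * c) + E * (1 - w * (1 - l * c))) -
      w * (1 - l ^ 2) * (1 + E) * (1 - w * (1 + l * c) + E * (1 - w * (1 - l * c))) -
      ((1 - w) ^ 2 - l ^ 2 * w ^ 2) * (1 + E) * ((1 + l * c) + E * (1 - l * c)) =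
      w * l ^ 2 * (4 * E + s ^ 2 * (E - 1) ^ 2) := by
    linear_combination (-(w * l ^ 2 * (E - 1) ^ 2)) * hcs
  generalize (1 + l * c) + E * (1 - l * c) = A at *
  generalize 1 - w * (1 + l * c) + E * (1 - w * (1 - l * c)) = B at *
  generalize 4 * E + s ^ 2 * (E - 1) ^ 2 = G at *
  have hD : δ ^ 2 * E / (1 + E) ^ 2 - w * A / (1 + E) * (δ ^ 2 * (1 - l ^ 2) * E / A ^ 2) -
      B / (1 + E) * (δ ^ 2 * ((1 - w) ^ 2 - l ^ 2 * w ^ 2) * E / B ^ 2) =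
      δ ^ 2 * E * (w * l ^ 2 * G) / ((1 + E) ^ 2 * A * B) := by
    rw [← hloss]
    field_simp
  rw [hD]
  field_simp
  ring

/-- Exact trade-off identity between information and information loss for qubit
thermometry: `F_β = κ(χ)·D^{(Δ)}` with `χ = sin θ` and
`κ(χ) = 2(1−χ²)/(2−χ²+χ²cosh(βδ))`. -/
theorem stmt10 (δ β : ℝ) (hδ : 0 < δ) (hβ : 0 < β) :
    ∀ w l θ φ : ℝ, 0 < w → w ≤ 1 / 2 → 0 ≤ l → l ≤ 1 →
      0 ≤ θ → θ ≤ π → 0 ≤ φ → φ < 2 * π →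
      fisherInfo δ β w l θ φ =
        (2 * (1 - Real.sin θ ^ 2) /
          (2 - Real.sin θ ^ 2 + Real.sin θ ^ 2 * Real.cosh (β * δ))) *
          deltaDist δ β w l θ φ := by
  intro w l θ φ hw hw2 hl hl1 _ _ _ _
  have hE := Real.exp_pos (β * δ)
  have hx : |l * Real.cos θ| ≤ 1 := by
    rw [abs_mul, abs_of_nonneg hl]
    exact mul_le_one₀ hl1 (abs_nonneg _) (Real.abs_cos_le_one θ)
  obtain ⟨hx1, hx2⟩ := abs_le.mp hx
  have hA : 0 < (1 + l * Real.cos θ) + Real.exp (β * δ) * (1 - l * Real.cos θ) := by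
    rcases hx1.eq_or_lt with h | h
    · rw [← h]
      linarith
    · have := mul_nonneg hE.le (sub_nonneg.mpr hx2)
      linarith
  have hu : 0 ≤ 1 - w * (1 + l * Real.cos θ) := by nlinarith
  have hv : 0 ≤ 1 - w * (1 - l * Real.cos θ) := by nlinarith
  have hB : 0 < 1 - w * (1 + l * Real.cos θ) +
      Real.exp (β * δ) * (1 - w * (1 - l * Real.cos θ)) := by
    rcases hu.eq_or_lt with h | h
    · have : 0 < 1 - w * (1 - l * Real.cos θ) := by linarith
      have := mul_pos hE this
      linarith
    · have := mul_nonneg hE.le hv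
      linarith
  rw [fisherInfo, deriv_prob0]
  simp only [deltaDist, qfiModel, qfiPost0, qfiPost1, prob0_eq, cosh_eq_exp_sq_add_one_div]
  exact information_disturbance_identity hE hw.ne' (Real.cos_sq' θ) hA.ne' hB.ne'
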